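/- arXiv:2304.12590 — 5 statements merged into one kernel-verified Lean document; each statement's English description precedes it below -/
import Mathlib

section
/- For every integer n ≥ 5, the determinant of the Gram matrix G_n equals 0. -/
open Real

/-- The Gram matrix `G_n` of the truncated tetrahedron `T_n` (a slice of the Löbell
polyhedron `L_n`), with `c₁ = cos(π/n)`, `c₂ = cos(2π/n)`, `a_n = √(1 + 1/(2c₂))`,
`d_n = c₁/c₂`. Indices here are zero-based (paper's index `i` is `i - 1`). -/
noncomputable def lobellGram (n : ℕ) : Matrix (Fin 6) (Fin 6) ℝ :=
  let c₁ : ℝ := Real.cos (π / n)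
  let c₂ : ℝ := Real.cos (2 * π / n)
  let a : ℝ := Real.sqrt (1 + 1 / (2 * c₂))
  let d : ℝ := c₁ / c₂
  !![1, -c₁, 0, 0, 0, -(Real.sqrt 2 / 2);
     -c₁, 1, 0, 0, -(Real.sqrt 2 / 2), 0;
     0, 0, 1, -d, 0, -a;
     0, 0, -d, 1, -a, 0;
     0, -(Real.sqrt 2 / 2), 0, -a, 1, 0;
     -(Real.sqrt 2 / 2), 0, -a, 0, 0, 1]

/-- For every integer `n ≥ 5`, the determinant of the Gram matrix `G_n` equals `0`. -/
theorem lobellGram_det_eq_zero (n : ℕ) (hn : 5 ≤ n) : (lobellGram n).det = 0 := by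
  have hn' : (5 : ℝ) ≤ n := by exact_mod_cast hn
  have hpos : (0 : ℝ) < n := by linarith
  have hpi := Real.pi_pos
  have h1 : 0 < Real.cos (π / n) := by
    apply Real.cos_pos_of_mem_Ioo
    constructor
    · have : 0 < π / n := by positivity
      linarith
    · rw [div_lt_div_iff₀ hpos (by norm_num)]
      nlinarith
  have h2 : 0 < Real.cos (2 * π / n) := by
    apply Real.cos_pos_of_mem_Ioo
    constructor
    · have : 0 < 2 * π / n := by positivity
      linarith
    · rw [div_lt_div_iff₀ hpos (by norm_num)]
      nlinarith
  have h3 : Real.cos (2 * π / n) = 2 * Real.cos (π / n) ^ 2 - 1 := by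
    rw [← Real.cos_two_mul]; congr 1; ring
  have ha : Real.sqrt (1 + 1 / (2 * Real.cos (2 * π / n))) ^ 2
      = 1 + 1 / (2 * Real.cos (2 * π / n)) := Real.sq_sqrt (by positivity)
  have hs : Real.sqrt 2 ^ 2 = 2 := Real.sq_sqrt (by norm_num)
  rw [← Matrix.exists_mulVec_eq_zero_iff]
  unfold lobellGram
  dsimp only
  generalize Real.sqrt (1 + 1 / (2 * Real.cos (2 * π / n))) = a at *
  generalize Real.sqrt 2 = s at *
  generalize Real.cos (2 * π / n) = c₂ at *
  generalize Real.cos (π / n) = c at *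
  -- the antisymmetric null vector `(x, -x, y, -y, 1, -1)`
  obtain ⟨x, hx⟩ : ∃ x, x = -(s / 2) / (1 + c) := ⟨_, rfl⟩
  obtain ⟨y, hy⟩ : ∃ y, y = -a / (1 + c / c₂) := ⟨_, rfl⟩
  have e1 : x + c * x + s / 2 = 0 := by
    rw [hx]; field_simp; ring
  have hd : 0 < 1 + c / c₂ := by positivity
  have e2 : y + c / c₂ * y + a = 0 := by
    rw [hy]; field_simp; ring
  have e3 : s / 2 * x + a * y + 1 = 0 := by
    have hx' : s / 2 * x = -(1 / 2) / (1 + c) := by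
      rw [hx, show s / 2 * (-(s / 2) / (1 + c)) = -(s ^ 2 / 4) / (1 + c) by ring, hs]; norm_num
    have hy' : a * y = -(1 + 1 / (2 * c₂)) / (1 + c / c₂) := by
      rw [hy, ← ha]; ring
    have hcc : 0 < c₂ + c := by positivity
    have : (1 + 1 / (2 * c₂)) / (1 + c / c₂) = (2 * c₂ + 1) / (2 * (c₂ + c)) := by
      field_simp
    rw [hx', hy', neg_div, neg_div, this]
    field_simp
    rw [h3]; ring
  refine ⟨![x, -x, y, -y, 1, -1], ?_, ?_⟩
  · intro h
    have := congrFun h 4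
    simp at this
  · ext i
    fin_cases i <;> simp [Matrix.mulVec, dotProduct, Fin.sum_univ_succ] <;> linarith
end

section
/- For every integer n ≥ 5, the real symmetric matrix G_n has signature (3,1,2): counted with multiplicity, exactly 3 of its eigenvalues are positive, exactly 1 is negative, and exactly 2 are zero; in particular G_n has rank 4. -/
open Real

theorem lobell_det {R : Type*} [CommRing R] (u c d a s : R) :
    Matrix.det !![u, c, 0, 0, 0, s;
     c, u, 0, 0, s, 0;
     0, 0, u, d, 0, a;
     0, 0, d, u, a, 0;
     0, s, 0, a, u, 0;
     s, 0, a, 0, 0, u] =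
    ((u + c) * (u + d) * u - (u + c) * a ^ 2 - (u + d) * s ^ 2) *
    ((u - c) * (u - d) * u - (u - c) * a ^ 2 - (u - d) * s ^ 2) := by
  simp [Matrix.det_succ_row_zero, Fin.sum_univ_succ, Fin.succAbove, Matrix.submatrix]
  ring

theorem lobell_roots (t e : ℝ) (h : 0 ≤ t ^ 2 - 4 * e) :
    ∃ p q : ℝ, p ≤ q ∧ p + q = t ∧ p * q = e := by
  refine ⟨(t - √(t ^ 2 - 4 * e)) / 2, (t + √(t ^ 2 - 4 * e)) / 2, ?_, by ring, ?_⟩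
  · have := Real.sqrt_nonneg (t ^ 2 - 4 * e)
    linarith
  · have := Real.sq_sqrt h
    linear_combination (-1 / 4) * this

theorem lobell_count {M : Matrix (Fin 6) (Fin 6) ℝ} (hG : M.IsHermitian) (P : ℝ → Prop)
    [DecidablePred P] :
    (Finset.univ.filter fun i => P (hG.eigenvalues i)).card = M.charpoly.roots.countP P := by
  rw [hG.roots_charpoly_eq_eigenvalues, Multiset.countP_map]
  rfl

/-- For every integer `n ≥ 5`, the real symmetric matrix `G_n` has signature `(3,1,2)`:
counted with multiplicity, exactly 3 eigenvalues are positive, exactly 1 is negative,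
and exactly 2 are zero; in particular `G_n` has rank 4. -/
theorem lobellGram_signature (n : ℕ) (hn : 5 ≤ n) :
    ∃ hG : (lobellGram n).IsHermitian,
      (Finset.univ.filter fun i => 0 < hG.eigenvalues i).card = 3 ∧
      (Finset.univ.filter fun i => hG.eigenvalues i < 0).card = 1 ∧
      (Finset.univ.filter fun i => hG.eigenvalues i = 0).card = 2 ∧
      (lobellGram n).rank = 4 := by
  have hn' : (5 : ℝ) ≤ n := by exact_mod_cast hn
  have hpi := Real.pi_pos
  have hx1 : π / n ≤ π / 5 := by gcongr
  have hx0 : 0 < π / n := by positivity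
  have e2 : 2 * π / n = 2 * (π / n) := by ring
  have hc2 : 0 < Real.cos (2 * π / n) := by
    apply Real.cos_pos_of_mem_Ioo
    constructor <;> linarith
  have hc1 : 0 < Real.cos (π / n) := by
    apply Real.cos_pos_of_mem_Ioo
    constructor <;> linarith
  have hc1' : Real.cos (π / n) ≤ 1 := Real.cos_le_one _
  have hrel : Real.cos (2 * π / n) = 2 * Real.cos (π / n) ^ 2 - 1 := by
    rw [e2, Real.cos_two_mul]
  obtain ⟨M, hdef⟩ : ∃ M, M = lobellGram n := ⟨_, rfl⟩
  rw [← hdef]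
  unfold lobellGram at hdef
  dsimp only at hdef
  generalize Real.cos (π / n) = c at *
  generalize Real.cos (2 * π / n) = k at *
  have ha : √(1 + 1 / (2 * k)) ^ 2 = 1 + 1 / (2 * k) := Real.sq_sqrt (by positivity)
  have hs : (√2 / 2) ^ 2 = 1 / 2 := by
    rw [div_pow, Real.sq_sqrt (by norm_num)]; norm_num
  generalize √(1 + 1 / (2 * k)) = a at *
  generalize √2 / 2 = s at *
  obtain ⟨j, hj⟩ : ∃ j, j = 1 / k := ⟨_, rfl⟩
  have hj0 : 0 < j := by rw [hj]; positivity
  have hjk : j * k = 1 := by rw [hj]; field_simp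
  have hd : c / k = c * j := by rw [hj]; ring
  have ha' : a ^ 2 = 1 + j / 2 := by rw [ha, hj]; field_simp
  rw [hd] at hdef
  have hG : M.IsHermitian := by
    rw [hdef]
    ext i j
    fin_cases i <;> fin_cases j <;> simp
  obtain ⟨p, q, hpq, hpq1, hpq2⟩ := lobell_roots (3 - c - c * j)
    (3 / 2 - 2 * c - 2 * (c * j) + c * (c * j) - j / 2)
    (by nlinarith [sq_nonneg (c - c * j), mul_pos hc1 hj0])
  obtain ⟨r, v, hrv, hrv1, hrv2⟩ := lobell_roots (3 + c + c * j)
    (3 / 2 + 2 * c + 2 * (c * j) + c * (c * j) - j / 2)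
    (by nlinarith [sq_nonneg (c - c * j), mul_pos hc1 hj0,
      mul_nonneg (sub_nonneg.2 hc1') hj0.le])
  have hcj : 0 < c * j := mul_pos hc1 hj0
  have hccj : c * (c * j) = (j + 1) / 2 := by
    have : k * j = (2 * c ^ 2 - 1) * j := by rw [hrel]
    linarith
  have hc_half : 1 / 2 < c := by
    by_contra h
    nlinarith [mul_nonneg hc1.le (sub_nonneg.2 (not_lt.1 h))]
  have hkc : k ≤ c := by
    nlinarith [mul_nonneg (sub_nonneg.2 hc1') (by linarith : (0 : ℝ) ≤ 2 * c + 1)]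
  have hcj1 : 1 ≤ c * j := by
    linarith [mul_le_mul_of_nonneg_left hkc hj0.le, mul_comm c j]
  have hneg : p * q < 0 := by rw [hpq2]; linarith
  have hpos : 0 < r * v := by rw [hrv2]; linarith
  have hp : p < 0 := by
    by_contra h
    have h' := not_lt.1 h
    linarith [mul_nonneg h' (h'.trans hpq)]
  have hq : 0 < q := by
    by_contra h
    linarith [mul_nonneg_of_nonpos_of_nonpos hp.le (not_lt.1 h)]
  have hr : 0 < r := by
    by_contra h
    have h' := not_lt.1 h
    linarith [mul_nonpos_of_nonpos_of_nonneg h' (by linarith : 0 ≤ v)]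
  have hv : 0 < v := by linarith
  have hchar : M.charpoly =
      (({0, 0, p, q, r, v} : Multiset ℝ).map fun x => Polynomial.X - Polynomial.C x).prod := by
    have hmat : M.charmatrix =
      !![.X - 1, .C c, 0, 0, 0, .C s;
         .C c, .X - 1, 0, 0, .C s, 0;
         0, 0, .X - 1, .C (c * j), 0, .C a;
         0, 0, .C (c * j), .X - 1, .C a, 0;
         0, .C s, 0, .C a, .X - 1, 0;
         .C s, 0, .C a, 0, 0, .X - 1] := by
      rw [hdef]
      ext1 x y
      fin_cases x <;> fin_cases y <;> simp [Matrix.charmatrix]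
    rw [Matrix.charpoly, hmat, lobell_det]
    apply Polynomial.funext
    intro x
    simp
    have h1 : (x - 1 + c) * (x - 1 + c * j) * (x - 1) - (x - 1 + c) * a ^ 2
        - (x - 1 + c * j) * s ^ 2 = x * ((x - p) * (x - q)) := by
      rw [ha', hs]
      linear_combination (x ^ 2) * hpq1 - x * hpq2 - hccj
    have h2 : (x - 1 - c) * (x - 1 - c * j) * (x - 1) - (x - 1 - c) * a ^ 2
        - (x - 1 - c * j) * s ^ 2 = x * ((x - r) * (x - v)) := by
      rw [ha', hs]
      linear_combination (x ^ 2) * hrv1 - x * hrv2 - hccj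
    rw [h1, h2]
    ring
  have hroots : M.charpoly.roots = {0, 0, p, q, r, v} := by
    rw [hchar, Polynomial.roots_multiset_prod_X_sub_C]
  refine ⟨hG, ?_, ?_, ?_, ?_⟩
  · rw [lobell_count hG (fun x => 0 < x), hroots]
    simp [Multiset.insert_eq_cons, Multiset.countP_cons, ← Multiset.cons_zero, hp.not_gt, hq, hr, hv]
  · rw [lobell_count hG (fun x => x < 0), hroots]
    simp [Multiset.insert_eq_cons, Multiset.countP_cons, ← Multiset.cons_zero, hp, hq.not_gt, hr.not_gt, hv.not_gt]
  · rw [lobell_count hG (fun x => x = 0), hroots]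
    simp [Multiset.insert_eq_cons, Multiset.countP_cons, ← Multiset.cons_zero, hp.ne, hq.ne', hr.ne', hv.ne']
  · rw [hG.rank_eq_card_non_zero_eigs, Fintype.card_subtype,
      lobell_count hG (fun x => x ≠ 0), hroots]
    simp [Multiset.insert_eq_cons, Multiset.countP_cons, ← Multiset.cons_zero, hp.ne, hq.ne', hr.ne', hv.ne']
end

section
/- The real symmetric 6×6 matrix M with all diagonal entries 1 and off-diagonal entries: (1,2) = (2,1) = −√2(1−√3)/4; (1,6) = (6,1) = (2,5) = (5,2) = −√2/2; (3,4) = (4,3) = −√2(3−√3)/6; (3,6) = (6,3) = (4,5) = (5,4) = −sqrt((3−√3)/3); all other off-diagonal entries 0, is positive semidefinite and has rank 4 (i.e., signature (4,0,2)). -/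
open Real

/-- The image `G₁₂^σ` of the Gram matrix of the slice `T₁₂` of the Löbell polyhedron
`L₁₂` under a field embedding sending `√3` to `−√3`. -/
noncomputable def lobellGram12Conj : Matrix (Fin 6) (Fin 6) ℝ :=
  !![1, -(Real.sqrt 2 * (1 - Real.sqrt 3) / 4), 0, 0, 0, -(Real.sqrt 2 / 2);
     -(Real.sqrt 2 * (1 - Real.sqrt 3) / 4), 1, 0, 0, -(Real.sqrt 2 / 2), 0;
     0, 0, 1, -(Real.sqrt 2 * (3 - Real.sqrt 3) / 6), 0,
       -(Real.sqrt ((3 - Real.sqrt 3) / 3));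
     0, 0, -(Real.sqrt 2 * (3 - Real.sqrt 3) / 6), 1,
       -(Real.sqrt ((3 - Real.sqrt 3) / 3)), 0;
     0, -(Real.sqrt 2 / 2), 0, -(Real.sqrt ((3 - Real.sqrt 3) / 3)), 1, 0;
     -(Real.sqrt 2 / 2), 0, -(Real.sqrt ((3 - Real.sqrt 3) / 3)), 0, 0, 1]

/-- `M = Rᵀ D R` under the polynomial relations making the Schur complement vanish. -/
lemma gram_general (a b c d u v : ℝ) (hu : u * (1 - a ^ 2) = 1) (hv : v * (1 - c ^ 2) = 1)
    (h1 : b ^ 2 * u + d ^ 2 * v = 1) (h2 : a * b ^ 2 * u + c * d ^ 2 * v = 0)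
    (ha : 0 < 1 - a ^ 2) (hc : 0 < 1 - c ^ 2) (M : Matrix (Fin 6) (Fin 6) ℝ)
    (hM : M = !![1, a, 0, 0, 0, b; a, 1, 0, 0, b, 0; 0, 0, 1, c, 0, d;
      0, 0, c, 1, d, 0; 0, b, 0, d, 1, 0; b, 0, d, 0, 0, 1]) :
    M.PosSemidef ∧ M.rank = 4 := by
  set R : Matrix (Fin 4) (Fin 6) ℝ :=
    !![1, a, 0, 0, 0, b; 0, 1, 0, 0, b * u, -(a * b * u);
       0, 0, 1, c, 0, d; 0, 0, 0, 1, d * v, -(c * d * v)] with hR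
  set D : Matrix (Fin 4) (Fin 4) ℝ := Matrix.diagonal ![1, 1 - a ^ 2, 1, 1 - c ^ 2] with hD
  have hfac : M = R.conjTranspose * D * R := by
    rw [hM, hR, hD]
    ext i j
    fin_cases i <;> fin_cases j <;>
      simp [Matrix.mul_apply, Fin.sum_univ_succ, Matrix.diagonal_apply, Matrix.conjTranspose_apply] <;>
      grind
  have hDp : D.PosSemidef := by
    rw [hD]
    apply Matrix.PosSemidef.diagonal
    intro i
    fin_cases i
    exacts [zero_le_one, ha.le, zero_le_one, hc.le]
  refine ⟨hfac ▸ hDp.conjTranspose_mul_mul_same R, le_antisymm ?_ ?_⟩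
  · rw [hfac]
    refine (Matrix.rank_mul_le_right _ _).trans ?_
    exact Matrix.rank_le_height R
  · have hs : (M.submatrix (Fin.castLE (by norm_num : 4 ≤ 6))
        (Fin.castLE (by norm_num : 4 ≤ 6))).det = (1 - a ^ 2) * (1 - c ^ 2) := by
      have : M.submatrix (Fin.castLE (by norm_num : 4 ≤ 6))
        (Fin.castLE (by norm_num : 4 ≤ 6)) = !![1, a, 0, 0; a, 1, 0, 0; 0, 0, 1, c; 0, 0, c, 1] := by
        rw [hM]
        ext i j
        fin_cases i <;> fin_cases j <;> rfl
      rw [this]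
      simp [Matrix.det_succ_row_zero, Fin.sum_univ_succ, Fin.succAbove]
      ring
    have hr := Matrix.rank_of_isUnit _ ((Matrix.isUnit_iff_isUnit_det _).2
      (hs ▸ (mul_pos ha hc).ne'.isUnit))
    rw [Fintype.card_fin] at hr
    rw [← hr]
    exact Matrix.rank_submatrix_le _ _ _

/-- The matrix `G₁₂^σ` is positive semidefinite of rank 4 (signature `(4,0,2)`);
this is condition (V2) of Vinberg's criterion for the Löbell polyhedron `L₁₂`. -/
theorem lobellGram12Conj_posSemidef_rank_four :
    lobellGram12Conj.PosSemidef ∧ lobellGram12Conj.rank = 4 := by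
  have hs : Real.sqrt 2 ^ 2 = 2 := Real.sq_sqrt (by norm_num)
  have ht : Real.sqrt 3 ^ 2 = 3 := Real.sq_sqrt (by norm_num)
  have ht0 : 0 ≤ Real.sqrt 3 := Real.sqrt_nonneg 3
  have hd : Real.sqrt ((3 - Real.sqrt 3) / 3) ^ 2 = (3 - Real.sqrt 3) / 3 :=
    Real.sq_sqrt (by nlinarith)
  have ea : 1 - (-(Real.sqrt 2 * (1 - Real.sqrt 3) / 4)) ^ 2 = (2 + Real.sqrt 3) / 4 := by grind
  have ec : 1 - (-(Real.sqrt 2 * (3 - Real.sqrt 3) / 6)) ^ 2 = (1 + Real.sqrt 3) / 3 := by grind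
  refine gram_general _ _ _ _ (4 * (2 - Real.sqrt 3)) (3 * (Real.sqrt 3 - 1) / 2)
    ?_ ?_ ?_ ?_ ?_ ?_ _ rfl
  · rw [ea]; grind
  · rw [ec]; grind
  · grind
  · grind
  · rw [ea]; positivity
  · rw [ec]; positivity
end

section
/- The real symmetric 6×6 matrix M with all diagonal entries 1 and off-diagonal entries: (1,2) = (2,1) = −(1−√5)/4; (1,6) = (6,1) = (2,5) = (5,2) = −√2/2; (3,4) = (4,3) = −(3−√5)/2; (3,6) = (6,3) = (4,5) = (5,4) = −sqrt((3−√5)/2); all other off-diagonal entries 0, is positive semidefinite. -/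
open Real

/-- The image `G₅^σ` of the Gram matrix of the slice `T₅` of the Löbell polyhedron
`L₅` (the right-angled dodecahedron) under the field embedding sending `√5` to `−√5`. -/
noncomputable def lobellGram5Conj : Matrix (Fin 6) (Fin 6) ℝ :=
  !![1, -((1 - Real.sqrt 5) / 4), 0, 0, 0, -(Real.sqrt 2 / 2);
     -((1 - Real.sqrt 5) / 4), 1, 0, 0, -(Real.sqrt 2 / 2), 0;
     0, 0, 1, -((3 - Real.sqrt 5) / 2), 0, -(Real.sqrt ((3 - Real.sqrt 5) / 2));
     0, 0, -((3 - Real.sqrt 5) / 2), 1, -(Real.sqrt ((3 - Real.sqrt 5) / 2)), 0;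
     0, -(Real.sqrt 2 / 2), 0, -(Real.sqrt ((3 - Real.sqrt 5) / 2)), 1, 0;
     -(Real.sqrt 2 / 2), 0, -(Real.sqrt ((3 - Real.sqrt 5) / 2)), 0, 0, 1]


/-- The symmetric block: its quadratic form is a sum of two squares. -/
lemma lobell_sym_block (t w : ℝ) (ht : t ^ 2 = 5) (hw : w ^ 2 = 2) (p q r : ℝ) :
    (3 + t) / 4 * p ^ 2 + (t - 1) / 2 * q ^ 2 + r ^ 2 - w * p * r - (t - 1) * q * r
      = (3 + t) / 4 * (p - w / 2 * (3 - t) * r) ^ 2 + (t - 1) / 2 * (q - r) ^ 2 := by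
  grind

/-- The antisymmetric block: its quadratic form is a sum of two squares. -/
lemma lobell_anti_block (t w : ℝ) (ht : t ^ 2 = 5) (hw : w ^ 2 = 2) (p q r : ℝ) :
    (5 - t) / 4 * p ^ 2 + (5 - t) / 2 * q ^ 2 + r ^ 2 + w * p * r + (t - 1) * q * r
      = (5 - t) / 4 * (p + w / 2 * ((5 + t) / 5) * r) ^ 2
        + (5 - t) / 2 * (q + t / 5 * r) ^ 2 := by
  grind

/-- The matrix `G₅^σ` is positive semidefinite; this is condition (V2) of Vinberg's
criterion for arithmeticity of the Löbell polyhedron `L₅`. -/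
theorem lobellGram5Conj_posSemidef : lobellGram5Conj.PosSemidef := by
  have ht : Real.sqrt 5 ^ 2 = 5 := Real.sq_sqrt (by norm_num)
  have hw : Real.sqrt 2 ^ 2 = 2 := Real.sq_sqrt (by norm_num)
  have h0 : 0 ≤ Real.sqrt 5 := Real.sqrt_nonneg 5
  have h1 : 1 ≤ Real.sqrt 5 := by nlinarith
  have h5 : Real.sqrt 5 ≤ 5 := by nlinarith
  have hc : Real.sqrt ((3 - Real.sqrt 5) / 2) = (Real.sqrt 5 - 1) / 2 := by
    rw [Real.sqrt_eq_iff_mul_self_eq (by nlinarith) (by linarith)]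
    linarith
  refine Matrix.PosSemidef.of_dotProduct_mulVec_nonneg ?_ ?_
  · ext i j
    fin_cases i <;> fin_cases j <;> simp [lobellGram5Conj]
  · intro x
    have hs := lobell_sym_block _ _ ht hw (x 0 + x 1) (x 2 + x 3) (x 4 + x 5)
    have ha := lobell_anti_block _ _ ht hw (x 0 - x 1) (x 2 - x 3) (x 4 - x 5)
    have hs' := add_nonneg
      (mul_nonneg (by linarith : 0 ≤ (3 + Real.sqrt 5) / 4)
        (sq_nonneg (x 0 + x 1 - Real.sqrt 2 / 2 * (3 - Real.sqrt 5) * (x 4 + x 5))))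
      (mul_nonneg (by linarith : 0 ≤ (Real.sqrt 5 - 1) / 2)
        (sq_nonneg (x 2 + x 3 - (x 4 + x 5))))
    have ha' := add_nonneg
      (mul_nonneg (by linarith : 0 ≤ (5 - Real.sqrt 5) / 4)
        (sq_nonneg (x 0 - x 1 + Real.sqrt 2 / 2 * ((5 + Real.sqrt 5) / 5) * (x 4 - x 5))))
      (mul_nonneg (by linarith : 0 ≤ (5 - Real.sqrt 5) / 2)
        (sq_nonneg (x 2 - x 3 + Real.sqrt 5 / 5 * (x 4 - x 5))))
    rw [← hs] at hs'
    rw [← ha] at ha'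
    simp only [lobellGram5Conj, hc, dotProduct, Matrix.mulVec, Fin.sum_univ_six]
    simp
    linarith
end

section
/- The field ℚ(√2, sqrt(3+√3)), i.e., the intermediate field of ℝ/ℚ generated by √2 and sqrt(3+√3), contains √3, coincides with ℚ(√2, √3, sqrt(3+√3)), and has degree 8 over ℚ. -/
open Real

lemma lob_span (K : IntermediateField ℚ ℝ) (x : ℝ) (hx : x ^ 2 ∈ K) (y : ℝ)
    (hy : y ∈ (IntermediateField.adjoin K ({x} : Set ℝ))) :
    ∃ a ∈ K, ∃ b ∈ K, y = a + b * x := by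
  have halg : IsAlgebraic K x := by
    refine ⟨Polynomial.X ^ 2 - Polynomial.C (⟨x ^ 2, hx⟩ : K),
      Polynomial.X_pow_sub_C_ne_zero (by norm_num) _, ?_⟩
    simp
  rw [← IntermediateField.mem_toSubalgebra,
    IntermediateField.adjoin_simple_toSubalgebra_of_isAlgebraic halg] at hy
  induction hy using Algebra.adjoin_induction with
  | mem z hz =>
    rw [Set.mem_singleton_iff] at hz
    exact ⟨0, K.zero_mem, 1, K.one_mem, by simp [hz]⟩
  | algebraMap r => exact ⟨r, r.2, 0, K.zero_mem, by simp⟩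
  | add u v _ _ hu hv =>
    obtain ⟨a, ha, b, hb, rfl⟩ := hu
    obtain ⟨c, hc, d, hd, rfl⟩ := hv
    exact ⟨a + c, K.add_mem ha hc, b + d, K.add_mem hb hd, by ring⟩
  | mul u v _ _ hu hv =>
    obtain ⟨a, ha, b, hb, rfl⟩ := hu
    obtain ⟨c, hc, d, hd, rfl⟩ := hv
    exact ⟨a * c + b * d * x ^ 2, K.add_mem (K.mul_mem ha hc) (K.mul_mem (K.mul_mem hb hd) hx),
      a * d + b * c, K.add_mem (K.mul_mem ha hd) (K.mul_mem hb hc), by ring⟩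

lemma lob_deg (K : IntermediateField ℚ ℝ) (x : ℝ) (hx : x ^ 2 ∈ K) (hn : x ∉ K) :
    Module.finrank ℚ ((IntermediateField.adjoin K ({x} : Set ℝ)).restrictScalars ℚ) =
      Module.finrank ℚ K * 2 := by
  have hirr : Irreducible (Polynomial.X ^ 2 - Polynomial.C (⟨x ^ 2, hx⟩ : K)) := by
    apply X_pow_sub_C_irreducible_of_prime Nat.prime_two
    intro b hb
    have h : (b : ℝ) ^ 2 = x ^ 2 := congrArg Subtype.val hb
    rcases sq_eq_sq_iff_eq_or_eq_neg.1 h with h | h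
    · exact hn (h ▸ b.2)
    · apply hn
      have : x = -(b : ℝ) := by rw [h]; ring
      rw [this]
      exact K.neg_mem b.2
  have hmon : (Polynomial.X ^ 2 - Polynomial.C (⟨x ^ 2, hx⟩ : K)).Monic :=
    Polynomial.monic_X_pow_sub_C _ (by norm_num)
  have hev : Polynomial.aeval x (Polynomial.X ^ 2 - Polynomial.C (⟨x ^ 2, hx⟩ : K)) = 0 := by
    simp
  have hmin := minpoly.eq_of_irreducible_of_monic hirr hev hmon
  have hint : IsIntegral K x := ⟨_, hmon, hev⟩
  have h2 : Module.finrank K (IntermediateField.adjoin K ({x} : Set ℝ)) = 2 := by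
    rw [IntermediateField.adjoin.finrank hint, ← hmin, Polynomial.natDegree_X_pow_sub_C]
  have := Module.finrank_mul_finrank ℚ K (IntermediateField.adjoin K ({x} : Set ℝ))
  rw [h2] at this
  exact this.symm

lemma lob_ext (K : IntermediateField ℚ ℝ) (x : ℝ) (hx : x ^ 2 ∈ K) (hn : x ∉ K) :
    ∃ K' : IntermediateField ℚ ℝ, K ≤ K' ∧ x ∈ K' ∧
      Module.finrank ℚ K' = Module.finrank ℚ K * 2 ∧
      ∀ y ∈ K', ∃ a ∈ K, ∃ b ∈ K, y = a + b * x := by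
  refine ⟨(IntermediateField.adjoin K ({x} : Set ℝ)).restrictScalars ℚ, ?_, ?_, ?_, ?_⟩
  · intro z hz
    rw [IntermediateField.mem_restrictScalars]
    exact (IntermediateField.adjoin K ({x} : Set ℝ)).algebraMap_mem ⟨z, hz⟩
  · rw [IntermediateField.mem_restrictScalars]
    exact IntermediateField.mem_adjoin_simple_self _ _
  · exact lob_deg K x hx hn
  · intro y hy
    rw [IntermediateField.mem_restrictScalars] at hy
    exact lob_span K x hx y hy

lemma lob_six (q : ℚ) : q ^ 2 ≠ 6 := by
  intro h
  have : Irrational (√6) := by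
    have h : ¬ IsSquare (6 : ℕ) := by
      rintro ⟨r, hr⟩
      have : r ≤ 2 := by nlinarith
      interval_cases r <;> omega
    exact_mod_cast (irrational_sqrt_natCast_iff (n := 6)).2 h
  apply this
  refine ⟨|q|, ?_⟩
  have h' : ((q : ℝ)) ^ 2 = 6 := by exact_mod_cast h
  rw [← h', Real.sqrt_sq_eq_abs]; push_cast; rfl

lemma lob_two (q : ℚ) : q ^ 2 ≠ 2 := by
  intro h
  apply irrational_sqrt_two
  refine ⟨|q|, ?_⟩
  have h' : ((q : ℝ)) ^ 2 = 2 := by exact_mod_cast h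
  rw [← h', Real.sqrt_sq_eq_abs]; push_cast; rfl

lemma lob_sqrt_three : Irrational (√3) := by
  exact_mod_cast Nat.prime_three.irrational_sqrt

lemma lob_coeff (a b c d : ℚ) (h : (a : ℝ) + b * √3 = c + d * √3) : a = c ∧ b = d := by
  have hb : b = d := by
    by_contra hne
    have hne' : (b : ℝ) - d ≠ 0 := by
      rw [sub_ne_zero]; exact_mod_cast hne
    apply lob_sqrt_three
    refine ⟨(c - a) / (b - d), ?_⟩
    push_cast
    rw [div_eq_iff hne']
    linarith
  subst hb
  exact ⟨by exact_mod_cast add_right_cancel h, rfl⟩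

theorem lobell_12_field_degree_eight :
    Real.sqrt 3 ∈
      IntermediateField.adjoin ℚ
        ({Real.sqrt 2, Real.sqrt ((3 : ℝ) + Real.sqrt 3)} : Set ℝ) ∧
    IntermediateField.adjoin ℚ
        ({Real.sqrt 2, Real.sqrt ((3 : ℝ) + Real.sqrt 3)} : Set ℝ) =
      IntermediateField.adjoin ℚ
        ({Real.sqrt 2, Real.sqrt 3, Real.sqrt ((3 : ℝ) + Real.sqrt 3)} : Set ℝ) ∧
    Module.finrank ℚ
        (IntermediateField.adjoin ℚ
          ({Real.sqrt 2, Real.sqrt ((3 : ℝ) + Real.sqrt 3)} : Set ℝ)) = 8 := by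
  have s2 : (√2) ^ 2 = 2 := Real.sq_sqrt (by norm_num)
  have s3 : (√3) ^ 2 = 3 := Real.sq_sqrt (by norm_num)
  have ss : (√(3 + √3)) ^ 2 = 3 + √3 := Real.sq_sqrt (by positivity)
  set L := IntermediateField.adjoin ℚ ({√2, √(3 + √3)} : Set ℝ) with hL
  have m2 : √2 ∈ L := IntermediateField.subset_adjoin _ _ (by simp)
  have ms : √(3 + √3) ∈ L := IntermediateField.subset_adjoin _ _ (by simp)
  have m3 : √3 ∈ L := by
    have h : √3 = (√(3 + √3)) ^ 2 - 3 := by rw [ss]; ring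
    rw [h]
    exact L.sub_mem (pow_mem ms 2) (ofNat_mem L 3)
  have hEq : L = IntermediateField.adjoin ℚ ({√2, √3, √(3 + √3)} : Set ℝ) := by
    apply le_antisymm
    · apply IntermediateField.adjoin.mono
      intro z hz
      simp only [Set.mem_insert_iff, Set.mem_singleton_iff] at hz ⊢
      tauto
    · rw [IntermediateField.adjoin_le_iff]
      rintro z (rfl | rfl | rfl)
      exacts [m2, m3, ms]
  refine ⟨m3, hEq, ?_⟩
  have q1 : (√3) ^ 2 ∈ (⊥ : IntermediateField ℚ ℝ) := by rw [s3]; exact ofNat_mem _ 3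
  have n1 : √3 ∉ (⊥ : IntermediateField ℚ ℝ) := by
    intro h
    obtain ⟨p, hp⟩ := IntermediateField.mem_bot.1 h
    exact lob_sqrt_three ⟨p, by simpa using hp⟩
  obtain ⟨K1, -, mem1, d1, sp1⟩ := lob_ext _ _ q1 n1
  rw [IntermediateField.finrank_bot] at d1
  have q2 : (√2) ^ 2 ∈ K1 := by rw [s2]; exact ofNat_mem _ 2
  have form1 : ∀ y ∈ K1, ∃ p q : ℚ, y = p + q * √3 := by
    intro y hy
    obtain ⟨a, ha, b, hb, rfl⟩ := sp1 y hy
    obtain ⟨p, rfl⟩ := IntermediateField.mem_bot.1 ha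
    obtain ⟨q, rfl⟩ := IntermediateField.mem_bot.1 hb
    exact ⟨p, q, by simp⟩
  have n2 : √2 ∉ K1 := by
    intro h
    obtain ⟨p, q, hpq⟩ := form1 _ h
    have e : ((p ^ 2 + 3 * q ^ 2 : ℚ) : ℝ) + ((2 * p * q : ℚ) : ℝ) * √3
        = ((2 : ℚ) : ℝ) + ((0 : ℚ) : ℝ) * √3 := by
      push_cast
      rw [hpq] at s2
      linear_combination s2 - (q : ℝ) ^ 2 * s3
    obtain ⟨e1, e2⟩ := lob_coeff _ _ _ _ e
    have : p = 0 ∨ q = 0 := by simpa using e2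
    rcases this with rfl | rfl
    · exact lob_six (3 * q) (by linear_combination 3 * e1)
    · exact lob_two p (by linear_combination e1)
  obtain ⟨K2, le12, mem2, d2, sp2⟩ := lob_ext _ _ q2 n2
  have q3 : (√(3 + √3)) ^ 2 ∈ K2 := by
    rw [ss]; exact K2.add_mem (ofNat_mem _ 3) (le12 mem1)
  have n3 : √(3 + √3) ∉ K2 := by
    intro h
    obtain ⟨a, ha, b, hb, hab⟩ := sp2 _ h
    have key : a ^ 2 + 2 * b ^ 2 + 2 * a * b * √2 = 3 + √3 := by
      rw [← ss, hab]
      linear_combination -b ^ 2 * s2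
    have hz : 2 * a * b = 0 := by
      by_contra hne
      apply n2
      have : √2 = (3 + √3 - a ^ 2 - 2 * b ^ 2) / (2 * a * b) := by
        rw [eq_div_iff hne]; linear_combination key
      rw [this]
      have two : (2 : ℝ) ∈ K1 := ofNat_mem _ 2
      have three : (3 : ℝ) ∈ K1 := ofNat_mem _ 3
      exact K1.div_mem (K1.sub_mem (K1.sub_mem (K1.add_mem three mem1) (pow_mem ha 2))
        (K1.mul_mem two (pow_mem hb 2))) (K1.mul_mem (K1.mul_mem two ha) hb)
    have : a = 0 ∨ b = 0 := by simpa using hz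
    rcases this with rfl | rfl
    · obtain ⟨p, q, rfl⟩ := form1 _ hb
      have e : ((2 * (p ^ 2 + 3 * q ^ 2) : ℚ) : ℝ) + ((4 * p * q : ℚ) : ℝ) * √3
          = ((3 : ℚ) : ℝ) + ((1 : ℚ) : ℝ) * √3 := by
        push_cast
        linear_combination key - 2 * (q : ℝ) ^ 2 * s3
      obtain ⟨e1, e2⟩ := lob_coeff _ _ _ _ e
      apply lob_six (2 * (p ^ 2 - 3 * q ^ 2))
      linear_combination (2 * (p ^ 2 + 3 * q ^ 2) + 3) * e1 - 3 * (4 * p * q + 1) * e2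
    · obtain ⟨p, q, rfl⟩ := form1 _ ha
      have e : ((p ^ 2 + 3 * q ^ 2 : ℚ) : ℝ) + ((2 * p * q : ℚ) : ℝ) * √3
          = ((3 : ℚ) : ℝ) + ((1 : ℚ) : ℝ) * √3 := by
        push_cast
        linear_combination key - (q : ℝ) ^ 2 * s3
      obtain ⟨e1, e2⟩ := lob_coeff _ _ _ _ e
      apply lob_six (p ^ 2 - 3 * q ^ 2)
      linear_combination (p ^ 2 + 3 * q ^ 2 + 3) * e1 - 3 * (2 * p * q + 1) * e2
  obtain ⟨K3, le23, mem3, d3, sp3⟩ := lob_ext _ _ q3 n3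
  have hK : L = K3 := by
    apply le_antisymm
    · rw [hL, IntermediateField.adjoin_le_iff]
      rintro z (rfl | rfl)
      exacts [le23 mem2, mem3]
    · have l1 : K1 ≤ L := by
        intro y hy
        obtain ⟨a, ha, b, hb, rfl⟩ := sp1 y hy
        exact L.add_mem ((bot_le : ⊥ ≤ L) ha) (L.mul_mem ((bot_le : ⊥ ≤ L) hb) m3)
      have l2 : K2 ≤ L := by
        intro y hy
        obtain ⟨a, ha, b, hb, rfl⟩ := sp2 y hy
        exact L.add_mem (l1 ha) (L.mul_mem (l1 hb) m2)
      intro y hy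
      obtain ⟨a, ha, b, hb, rfl⟩ := sp3 y hy
      exact L.add_mem (l2 ha) (L.mul_mem (l2 hb) ms)
  rw [hK, d3, d2, d1]
end
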